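/- arXiv:1407.3612 — 4 statements merged into one kernel-verified Lean document; each statement's English description precedes it below -/
import Mathlib

section
/- Let M > 0 and Λ > 0 satisfy 9M²Λ < 1, and let r_b, r_c be real numbers with 0 < r_b < r_c and F(r_b) = F(r_c) = 0. Then 2M < r_b < 3M < r_c. -/
/-- Schwarzschild–de Sitter metric function `F(r) = 1 − 2M/r − (Λ/3)r²`. -/
noncomputable def SdSF (M Λ r : ℝ) : ℝ := 1 - 2*M/r - Λ/3 * r^2

/-- A positive zero of the metric function is a root of the horizon cubic. -/
theorem SdSF.cubic_eq_zero {M Λ r : ℝ} (hr : 0 < r) (hF : SdSF M Λ r = 0) :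
    Λ * r^3 - 3 * r + 6 * M = 0 := by
  unfold SdSF at hF
  field_simp at hF
  linarith

/-- For `M > 0`, `Λ > 0` with `9M²Λ < 1`, if `0 < r_b < r_c` are zeros of the
metric function `F`, then `2M < r_b < 3M < r_c`. -/
theorem sds_horizon_bounds (M Λ : ℝ) (hM : 0 < M) (hΛ : 0 < Λ)
    (h : 9 * M^2 * Λ < 1) (rb rc : ℝ) (hrb : 0 < rb) (hbc : rb < rc)
    (hFb : SdSF M Λ rb = 0) (hFc : SdSF M Λ rc = 0) :
    2*M < rb ∧ rb < 3*M ∧ 3*M < rc := by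
  have hb := SdSF.cubic_eq_zero hrb hFb
  have hc := SdSF.cubic_eq_zero (hrb.trans hbc) hFc
  have hsum : Λ * (rb^2 + rb * rc + rc^2) = 3 := by
    apply mul_left_cancel₀ (sub_ne_zero.mpr hbc.ne')
    linear_combination hc - hb
  have hfac : Λ * (3*M + rb + rc) * ((3*M - rb) * (3*M - rc)) = 3*M * (9 * M^2 * Λ - 1) := by
    linear_combination -hb - (3*M - rb) * hsum
  have hpos : 0 < Λ * (3*M + rb + rc) := by
    have := hrb.trans hbc
    positivity
  have hprod : (3*M - rb) * (3*M - rc) < 0 := by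
    refine neg_of_mul_neg_right ?_ hpos.le
    rw [hfac]
    exact mul_neg_of_pos_of_neg (by positivity) (by linarith)
  have hcube : 0 < Λ * rb^3 := by positivity
  rcases mul_neg_iff.mp hprod with ⟨h₁, h₂⟩ | ⟨h₁, h₂⟩
  · exact ⟨by linarith, by linarith, by linarith⟩
  · linarith
end

section
/- Let M > 0 and Λ > 0, let r_b, r_c be real with 0 < r_b < r_c and F(r_b) = F(r_c) = 0, and let κ_b := (r_c − r_b)(r_c + 2r_b)·Λ/(6·r_b) and κ_c := (r_c − r_b)(2r_c + r_b)·Λ/(6·r_c). Then for every r in the open interval (r_b, r_c), the tortoise coordinate function r⋆(r) := (1/(2κ_b))·log(r/r_b − 1) − (1/(2κ_c))·log(1 − r/r_c) − (1/2)·(1/κ_b − 1/κ_c)·log(r/(r_b + r_c) + 1) is differentiable at r with derivative equal to 1/F(r). -/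
/-- Two distinct positive zeros of `F` determine its factorization; the third root is
`-(rb + rc)`. -/
theorem SdSF_eq_of_zeros {M Λ rb rc r : ℝ} (hrb : rb ≠ 0) (hrc : rc ≠ 0) (hbc : rb ≠ rc)
    (hFb : SdSF M Λ rb = 0) (hFc : SdSF M Λ rc = 0) (hr : r ≠ 0) :
    SdSF M Λ r = Λ * (r - rb) * (rc - r) * (r + rb + rc) / (3 * r) := by
  have hb : 3 * rb - 6 * M - Λ * rb ^ 3 = 0 := by
    have h : 3 * rb - 6 * M - Λ * rb ^ 3 = 3 * rb * SdSF M Λ rb := by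
      unfold SdSF
      field_simp
      ring
    rw [h, hFb, mul_zero]
  have hc : 3 * rc - 6 * M - Λ * rc ^ 3 = 0 := by
    have h : 3 * rc - 6 * M - Λ * rc ^ 3 = 3 * rc * SdSF M Λ rc := by
      unfold SdSF
      field_simp
      ring
    rw [h, hFc, mul_zero]
  have hsum : Λ * (rb ^ 2 + rb * rc + rc ^ 2) = 3 :=
    mul_left_cancel₀ (sub_ne_zero.mpr hbc) (by linear_combination hc - hb)
  have key : 3 * r - 6 * M - Λ * r ^ 3 = Λ * (r - rb) * (rc - r) * (r + rb + rc) := by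
    linear_combination hb - (r - rb) * hsum
  rw [← key]
  unfold SdSF
  field_simp
  ring

/-- For `M > 0`, `Λ > 0` and horizon radii `0 < r_b < r_c` (zeros of `F`), with
surface gravities `κ_b` and `κ_c`, the tortoise coordinate
`r⋆(r) = (1/(2κ_b))log(r/r_b − 1) − (1/(2κ_c))log(1 − r/r_c)
        − (1/2)(1/κ_b − 1/κ_c)log(r/(r_b + r_c) + 1)`
is differentiable on `(r_b, r_c)` with derivative `1/F(r)`. -/
theorem sds_tortoise_derivative (M Λ : ℝ) (hM : 0 < M) (hΛ : 0 < Λ)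
    (rb rc : ℝ) (hrb : 0 < rb) (hbc : rb < rc)
    (hFb : SdSF M Λ rb = 0) (hFc : SdSF M Λ rc = 0) :
    let κb := (rc - rb) * (rc + 2*rb) * Λ / (6*rb)
    let κc := (rc - rb) * (2*rc + rb) * Λ / (6*rc)
    ∀ r ∈ Set.Ioo rb rc,
      HasDerivAt (fun s : ℝ =>
          (1/(2*κb)) * Real.log (s/rb - 1)
          - (1/(2*κc)) * Real.log (1 - s/rc)
          - (1/2) * (1/κb - 1/κc) * Real.log (s/(rb + rc) + 1))
        (1 / SdSF M Λ r) r := by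
  intro κb κc r hr
  obtain ⟨h1, h2⟩ := hr
  have hrc : 0 < rc := hrb.trans hbc
  have hr0 : 0 < r := hrb.trans h1
  have hrb' : r - rb ≠ 0 := (sub_pos.mpr h1).ne'
  have hrc' : rc - r ≠ 0 := (sub_pos.mpr h2).ne'
  have hd : rc - rb ≠ 0 := (sub_pos.mpr hbc).ne'
  have e1 : r / rb - 1 = (r - rb) / rb := by field_simp
  have e2 : 1 - r / rc = (rc - r) / rc := by field_simp
  have e3 : r / (rb + rc) + 1 = (r + rb + rc) / (rb + rc) := by
    field_simp
    ring
  have n1 : r / rb - 1 ≠ 0 := e1 ▸ div_ne_zero hrb' hrb.ne'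
  have n2 : 1 - r / rc ≠ 0 := e2 ▸ div_ne_zero hrc' hrc.ne'
  have n3 : r / (rb + rc) + 1 ≠ 0 := by positivity
  have d1 := ((((hasDerivAt_id' r).div_const rb).sub_const 1).log n1).const_mul (1 / (2 * κb))
  have d2 := ((((hasDerivAt_id' r).div_const rc).const_sub 1).log n2).const_mul (1 / (2 * κc))
  have d3 := ((((hasDerivAt_id' r).div_const (rb + rc)).add_const 1).log n3).const_mul
    ((1 / 2) * (1 / κb - 1 / κc))
  refine ((d1.sub d2).sub d3).congr_deriv ?_
  rw [SdSF_eq_of_zeros hrb.ne' hrc.ne' hbc.ne hFb hFc hr0.ne', e1, e2, e3]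
  have p1 : rc + 2 * rb ≠ 0 := by positivity
  have p2 : 2 * rc + rb ≠ 0 := by positivity
  have p3 : r + rb + rc ≠ 0 := by positivity
  simp only [κb, κc]
  field_simp
  ring
end

section
/- Let κ > 0 and define the weight w : ℝ → ℝ by w(k) := k·e^{πk/κ}/( e^{πk/κ} − e^{−πk/κ} ) for k ≠ 0 and w(0) := κ/(2π). Then: (i) w(k) > 0 for all k ≠ 0; (ii) w(−k) = e^{−2πk/κ}·w(k) for all k; (iii) for all continuous compactly supported g, h : ℝ → ℂ satisfying the reality conditions g(−k) = conj(g(k)) and h(−k) = conj(h(k)) for all k, and for every τ ∈ ℝ: ∫ e^{−iτk}·conj(g(k))·h(k)·w(k) dk = ∫ conj(h(k))·e^{iτk}·e^{−2πk/κ}·g(k)·w(k) dk. -/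
open MeasureTheory

/-- Properties of the horizon spectral weight `w(k) = k e^{πk/κ}/(e^{πk/κ} − e^{−πk/κ})`
(with `w(0) = κ/(2π)`): it is positive away from `0`, satisfies the detailed-balance
identity `w(−k) = e^{−2πk/κ} w(k)`, and the induced two-point function satisfies the
KMS condition at inverse temperature `2π/κ` for real horizon data. -/
theorem horizon_weight_kms (κ : ℝ) (hκ : 0 < κ) :
    let w : ℝ → ℝ := fun k => if k = 0 then κ / (2 * Real.pi)
      else k * Real.exp (Real.pi * k / κ)
        / (Real.exp (Real.pi * k / κ) - Real.exp (-(Real.pi * k / κ)))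
    (∀ k : ℝ, k ≠ 0 → 0 < w k) ∧
    (∀ k : ℝ, w (-k) = Real.exp (-(2 * Real.pi * k / κ)) * w k) ∧
    (∀ g h : ℝ → ℂ, Continuous g → HasCompactSupport g →
      Continuous h → HasCompactSupport h →
      (∀ k, g (-k) = (starRingEnd ℂ) (g k)) →
      (∀ k, h (-k) = (starRingEnd ℂ) (h k)) →
      ∀ τ : ℝ,
        (∫ k : ℝ, Complex.exp (-(τ * k) * Complex.I)
            * (starRingEnd ℂ) (g k) * h k * (w k : ℂ))
          = ∫ k : ℝ, (starRingEnd ℂ) (h k) * Complex.exp ((τ * k) * Complex.I)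
              * (Real.exp (-(2 * Real.pi * k / κ)) : ℂ) * g k * (w k : ℂ)) := by
  intro w
  have hpos : ∀ k : ℝ, k ≠ 0 → 0 < w k := by
    intro k hk
    simp only [w, if_neg hk]
    rcases lt_or_gt_of_ne hk with hneg | hpos
    · have hx : Real.pi * k / κ < 0 :=
        div_neg_of_neg_of_pos (mul_neg_of_pos_of_neg Real.pi_pos hneg) hκ
      exact div_pos_of_neg_of_neg (mul_neg_of_neg_of_pos hneg (Real.exp_pos _))
        (sub_neg.mpr (Real.exp_lt_exp.mpr (by linarith)))
    · have hx : 0 < Real.pi * k / κ := by positivity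
      exact div_pos (mul_pos hpos (Real.exp_pos _))
        (sub_pos.mpr (Real.exp_lt_exp.mpr (by linarith)))
  have hbal : ∀ k : ℝ, w (-k) = Real.exp (-(2 * Real.pi * k / κ)) * w k := by
    intro k
    by_cases hk : k = 0
    · simp [w, hk]
    · have hneg : Real.pi * -k / κ = -(Real.pi * k / κ) := by ring
      have hexp : Real.exp (-(2 * Real.pi * k / κ)) * Real.exp (Real.pi * k / κ)
          = Real.exp (-(Real.pi * k / κ)) := by
        rw [← Real.exp_add]
        congr 1
        ring
      simp only [w, if_neg hk, if_neg (neg_ne_zero.mpr hk), hneg, neg_neg]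
      rw [← neg_sub (Real.exp (Real.pi * k / κ)), neg_mul, neg_div_neg_eq, ← hexp]
      ring
  refine ⟨hpos, hbal, ?_⟩
  intro g h _ _ _ _ hg hh τ
  rw [← integral_neg_eq_self]
  refine integral_congr_ae (Filter.Eventually.of_forall fun k => ?_)
  simp only [hg, hh, hbal, Complex.conj_conj, Complex.ofReal_mul, Complex.ofReal_neg,
    mul_neg, neg_neg]
  ring
end

section
/- Let ψ₁, ψ₂ : ℝ → ℂ be Schwartz functions, and define their Fourier transforms by ψ̂(K) := (1/√(2π))·∫ e^{iKx}·ψ(x) dx. Then the limit lim_{ε→0⁺} ( −(1/π)·∫∫ conj(ψ₁(x))·ψ₂(y) / (x − y − iε)² dx dy ) exists and equals ∫₀^∞ conj(ψ̂₁(K))·ψ̂₂(K)·2K dK. In particular, for ψ₁ = ψ₂ the limit is a nonnegative real number. -/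
open MeasureTheory

section Laplace

open Set Filter Topology

theorem integrableOn_mul_exp_neg_mul_Ioi {r : ℝ} (hr : 0 < r) :
    IntegrableOn (fun K : ℝ => K * Real.exp (-r * K)) (Ioi 0) := by
  simpa using integrableOn_rpow_mul_exp_neg_mul_rpow (p := 1) (s := 1) (by norm_num)
    one_pos hr

theorem norm_mul_cexp_neg_mul {a : ℂ} {K : ℝ} (hK : 0 ≤ K) :
    ‖(K : ℂ) * Complex.exp (-a * K)‖ = K * Real.exp (-a.re * K) := by
  simp [Complex.norm_exp, abs_of_nonneg hK]

theorem integrableOn_mul_cexp_neg_mul_Ioi {a : ℂ} (ha : 0 < a.re) :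
    IntegrableOn (fun K : ℝ => (K : ℂ) * Complex.exp (-a * K)) (Ioi 0) := by
  refine (integrableOn_mul_exp_neg_mul_Ioi ha).mono'
    (Continuous.aestronglyMeasurable (by fun_prop)) ?_
  filter_upwards [ae_restrict_mem measurableSet_Ioi] with K hK
  exact (norm_mul_cexp_neg_mul (le_of_lt hK)).le

/-- The Laplace transform of `K ↦ K` is `a ↦ 1 / a ^ 2` on the right half-plane. -/
theorem integral_mul_cexp_neg_mul_Ioi {a : ℂ} (ha : 0 < a.re) :
    ∫ K in Ioi (0 : ℝ), (K : ℂ) * Complex.exp (-a * K) = 1 / a ^ 2 := by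
  have ha0 : a ≠ 0 := by
    rintro rfl
    simp at ha
  have hexp : Tendsto (fun K : ℝ => Complex.exp (-a * K)) atTop (𝓝 0) := by
    rw [tendsto_zero_iff_norm_tendsto_zero]
    simpa [Complex.norm_exp] using tendsto_rpow_mul_exp_neg_mul_atTop_nhds_zero 0 a.re ha
  have hmul : Tendsto (fun K : ℝ => (K : ℂ) * Complex.exp (-a * K)) atTop (𝓝 0) := by
    rw [tendsto_zero_iff_norm_tendsto_zero]
    have h := tendsto_rpow_mul_exp_neg_mul_atTop_nhds_zero 1 a.re ha
    refine h.congr' ?_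
    filter_upwards [eventually_ge_atTop 0] with K hK
    rw [norm_mul_cexp_neg_mul hK, Real.rpow_one]
  have hderiv (K : ℝ) : HasDerivAt
      (fun K : ℝ => -(1 / a) * ((K : ℂ) * Complex.exp (-a * K))
        - 1 / a ^ 2 * Complex.exp (-a * K))
      ((K : ℂ) * Complex.exp (-a * K)) K := by
    have h1 : HasDerivAt (fun K : ℝ => (K : ℂ)) 1 K := Complex.ofRealCLM.hasDerivAt
    have h2 := (h1.const_mul (-a)).cexp
    convert! ((h1.mul h2).const_mul (-(1 / a))).sub (h2.const_mul (1 / a ^ 2)) using 1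
    field_simp
    ring
  have hlim := (hmul.const_mul (-(1 / a))).sub (hexp.const_mul (1 / a ^ 2))
  rw [integral_Ioi_of_hasDerivAt_of_tendsto' (fun K _ => hderiv K)
    (integrableOn_mul_cexp_neg_mul_Ioi ha) hlim]
  simp

end Laplace

section Fourier

open scoped FourierTransform SchwartzMap

theorem SchwartzMap.exists_eq_integral_cexp_mul (ψ : 𝓢(ℝ, ℂ)) :
    ∃ A : 𝓢(ℝ, ℂ), ∀ K : ℝ, A K = ∫ x : ℝ, Complex.exp (Complex.I * K * x) * ψ x := by
  have hc : -(2 * Real.pi)⁻¹ ≠ 0 := by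
    have := Real.pi_pos
    exact neg_ne_zero.mpr (by positivity)
  refine ⟨SchwartzMap.compCLMOfContinuousLinearEquiv ℂ
    (ContinuousLinearEquiv.unitsEquivAut ℝ (Units.mk0 _ hc)) (𝓕 ψ), fun K => ?_⟩
  simp only [SchwartzMap.compCLMOfContinuousLinearEquiv_apply, Function.comp_apply,
    SchwartzMap.fourier_coe, Real.fourier_real_eq_integral_exp_smul, smul_eq_mul]
  congr! 4 with x
  have := Real.pi_ne_zero
  simp
  field_simp

/-- Fubini: the Fourier-type kernel may be moved from one integration to the other. -/
theorem integral_mul_integral_mul_cexp {φ h : ℝ → ℂ} {μ ν : Measure ℝ} [SFinite μ] [SFinite ν]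
    (hφ : Integrable φ μ) (hh : Integrable h ν) (s : ℝ) :
    ∫ y, φ y * ∫ K, h K * Complex.exp (Complex.I * s * K * y) ∂ν ∂μ
      = ∫ K, h K * ∫ y, Complex.exp (Complex.I * s * K * y) * φ y ∂μ ∂ν := by
  simp_rw [← integral_const_mul]
  rw [integral_integral_swap]
  · congr! 4
    ring
  · refine (hφ.mul_prod hh).mono ?_ (ae_of_all _ fun p => le_of_eq ?_)
    · have hmeas := (hφ.mul_prod hh).aestronglyMeasurable.mul
        (Continuous.aestronglyMeasurable (μ := μ.prod ν)
        (f := fun p : ℝ × ℝ => Complex.exp (Complex.I * s * p.2 * p.1)) (by fun_prop))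
      refine hmeas.congr (ae_of_all _ fun p => ?_)
      simp [Function.uncurry, mul_assoc]
    · simp [Function.uncurry, Complex.norm_exp]

end Fourier

section TwoPoint

open Set Filter Topology
open scoped SchwartzMap

theorem SchwartzMap.integrable_mul_id (A : 𝓢(ℝ, ℂ)) :
    Integrable fun K : ℝ => A K * (K : ℂ) := by
  refine (A.integrable_pow_mul volume 1).mono
    (Continuous.aestronglyMeasurable (by fun_prop)) (ae_of_all _ fun K => ?_)
  simp [mul_comm]

theorem norm_ofReal_exp_neg_mul_le_one {ε K : ℝ} (hε : 0 ≤ ε) (hK : 0 ≤ K) :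
    ‖(Real.exp (-ε * K) : ℂ)‖ ≤ 1 := by
  rw [Complex.norm_real, Real.norm_eq_abs, Real.abs_exp, Real.exp_le_one_iff, neg_mul]
  exact neg_nonpos.mpr (mul_nonneg hε hK)

theorem integrableOn_exp_neg_mul_mul {ε : ℝ} (hε : 0 ≤ ε) {h : ℝ → ℂ} (hh : Integrable h) :
    IntegrableOn (fun K : ℝ => (Real.exp (-ε * K) : ℂ) * h K) (Ioi 0) := by
  refine hh.integrableOn.bdd_mul (c := 1) (Continuous.aestronglyMeasurable (by fun_prop)) ?_
  filter_upwards [ae_restrict_mem measurableSet_Ioi] with K hK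
  exact norm_ofReal_exp_neg_mul_le_one hε (le_of_lt hK)

/-- Abel summation of an integrable function on the half-line. -/
theorem tendsto_integral_exp_neg_mul_mul {h : ℝ → ℂ} (hh : Integrable h) :
    Tendsto (fun ε : ℝ => ∫ K in Ioi (0 : ℝ), (Real.exp (-ε * K) : ℂ) * h K) (𝓝[>] 0)
      (𝓝 (∫ K in Ioi (0 : ℝ), h K)) := by
  refine tendsto_integral_filter_of_dominated_convergence (fun K => ‖h K‖) ?_ ?_
    hh.norm.integrableOn (ae_of_all _ fun K => ?_)
  · filter_upwards [self_mem_nhdsWithin] with ε hε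
    exact (integrableOn_exp_neg_mul_mul (le_of_lt hε) hh).aestronglyMeasurable
  · filter_upwards [self_mem_nhdsWithin] with ε hε
    filter_upwards [ae_restrict_mem measurableSet_Ioi] with K hK
    rw [norm_mul]
    exact mul_le_of_le_one_left (norm_nonneg _)
      (norm_ofReal_exp_neg_mul_le_one (le_of_lt hε) (le_of_lt hK))
  · have hc : Continuous fun ε : ℝ => (Real.exp (-ε * K) : ℂ) * h K := by fun_prop
    simpa using (hc.tendsto 0).mono_left nhdsWithin_le_nhds

theorem SchwartzMap.integrable_conj_mul_mul_id (A₁ A₂ : 𝓢(ℝ, ℂ)) :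
    Integrable fun K : ℝ => (starRingEnd ℂ) (A₁ K) * A₂ K * (K : ℂ) := by
  obtain ⟨C, hC⟩ := A₁.decay 0 0
  have := A₂.integrable_mul_id.bdd_mul (c := C) (f := fun K => (starRingEnd ℂ) (A₁ K))
    (Continuous.aestronglyMeasurable (by fun_prop)) (ae_of_all _ fun K => by simpa using hC.2 K)
  simpa only [mul_assoc] using this

theorem integral_integral_div_sub_sub_sq {ψ₁ ψ₂ A₁ A₂ : 𝓢(ℝ, ℂ)}
    (h₁ : ∀ K : ℝ, A₁ K = ∫ x : ℝ, Complex.exp (Complex.I * K * x) * ψ₁ x)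
    (h₂ : ∀ K : ℝ, A₂ K = ∫ x : ℝ, Complex.exp (Complex.I * K * x) * ψ₂ x)
    {ε : ℝ} (hε : 0 < ε) :
    ∫ x : ℝ, ∫ y : ℝ,
        (starRingEnd ℂ) (ψ₁ x) * ψ₂ y / (((x : ℂ) - (y : ℂ) - (ε : ℂ) * Complex.I) ^ 2)
      = -∫ K in Ioi (0 : ℝ), (Real.exp (-ε * K) : ℂ) *
          ((starRingEnd ℂ) (A₁ K) * A₂ K * (K : ℂ)) := by
  have hker (x y : ℝ) :
      (starRingEnd ℂ) (ψ₁ x) * ψ₂ y / (((x : ℂ) - (y : ℂ) - (ε : ℂ) * Complex.I) ^ 2)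
        = -((starRingEnd ℂ) (ψ₁ x) * (ψ₂ y * ∫ K in Ioi (0 : ℝ),
          ((K : ℂ) * Complex.exp (-(ε + Complex.I * x) * K))
            * Complex.exp (Complex.I * (1 : ℝ) * K * y))) := by
    have ha : 0 < (Complex.I * ((x : ℂ) - y - ε * Complex.I)).re := by simpa using hε
    have hlaplace := integral_mul_cexp_neg_mul_Ioi ha
    rw [mul_pow, Complex.I_sq, neg_one_mul, one_div, inv_neg] at hlaplace
    rw [div_eq_mul_inv, ← neg_eq_iff_eq_neg.mpr hlaplace, mul_neg, mul_assoc]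
    congr 3
    refine integral_congr_ae (ae_of_all _ fun K => ?_)
    simp only [mul_assoc, ← Complex.exp_add]
    congr! 2
    rw [Complex.ofReal_one]
    linear_combination (ε * K : ℂ) * Complex.I_sq
  have hinner (x : ℝ) :
      ∫ y : ℝ, (starRingEnd ℂ) (ψ₁ x) * ψ₂ y / (((x : ℂ) - (y : ℂ) - (ε : ℂ) * Complex.I) ^ 2)
        = -((starRingEnd ℂ) (ψ₁ x) * ∫ K in Ioi (0 : ℝ),
          ((Real.exp (-ε * K) : ℂ) * (A₂ K * K))
            * Complex.exp (Complex.I * ((-1 : ℝ) : ℂ) * K * x)) := by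
    simp_rw [hker]
    rw [integral_neg, integral_const_mul, integral_mul_integral_mul_cexp ψ₂.integrable
      (integrableOn_mul_cexp_neg_mul_Ioi (by simpa using hε))]
    congr 2
    refine integral_congr_ae (ae_of_all _ fun K => ?_)
    have hexp : Complex.exp (-(ε + Complex.I * x) * K)
        = Complex.exp (-ε * K) * Complex.exp (Complex.I * (-1 : ℝ) * K * x) := by
      rw [← Complex.exp_add]
      congr 1
      push_cast
      ring
    simp only [hexp, h₂]
    push_cast
    simp only [mul_one]
    ring
  simp_rw [hinner]
  have hconj (K : ℝ) : (starRingEnd ℂ) (A₁ K)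
      = ∫ x : ℝ, Complex.exp (Complex.I * ((-1 : ℝ) : ℂ) * K * x) * (starRingEnd ℂ) (ψ₁ x) := by
    rw [h₁, ← integral_conj]
    simp [← Complex.exp_conj]
  have hψ : Integrable fun x => (starRingEnd ℂ) (ψ₁ x) :=
    ψ₁.integrable.mono (Continuous.aestronglyMeasurable (by fun_prop))
      (ae_of_all _ fun x => by simp)
  rw [integral_neg, integral_mul_integral_mul_cexp hψ
    (integrableOn_exp_neg_mul_mul hε.le A₂.integrable_mul_id)]
  simp_rw [← hconj]
  congr! 3
  ring

theorem conj_mul_self_mul_ofReal (z : ℂ) (r : ℝ) :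
    (starRingEnd ℂ) z * z * r = ((Complex.normSq z * r : ℝ) : ℂ) := by
  rw [← Complex.normSq_eq_conj_mul_self, Complex.ofReal_mul]

end TwoPoint

/-- The horizon two-point function in position space converges, as `ε → 0⁺`, to its
Fourier-space form over positive frequencies:
`lim_{ε→0⁺} −(1/π)∫∫ conj(ψ₁(x))ψ₂(y)/(x − y − iε)² dx dy
  = ∫₀^∞ conj(ψ̂₁(K)) ψ̂₂(K) · 2K dK`,
with `ψ̂(K) = (1/√(2π))∫ e^{iKx}ψ(x) dx`; in particular for `ψ₁ = ψ₂` the limit is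
a nonnegative real number. -/
theorem horizon_two_point_fourier (ψ₁ ψ₂ : SchwartzMap ℝ ℂ) :
    let FT : SchwartzMap ℝ ℂ → ℝ → ℂ := fun ψ K =>
      (1 / (Real.sqrt (2 * Real.pi)) : ℂ)
        * ∫ x : ℝ, Complex.exp (Complex.I * K * x) * ψ x
    let L : ℂ := ∫ K in Set.Ioi (0:ℝ),
      (starRingEnd ℂ) (FT ψ₁ K) * FT ψ₂ K * (2 * (K : ℂ))
    Filter.Tendsto
      (fun ε : ℝ => -(1 / (Real.pi : ℂ)) * ∫ x : ℝ, ∫ y : ℝ,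
        (starRingEnd ℂ) (ψ₁ x) * ψ₂ y / (((x : ℂ) - (y : ℂ) - (ε : ℂ) * Complex.I) ^ 2))
      (nhdsWithin 0 (Set.Ioi 0)) (nhds L) ∧
    (ψ₁ = ψ₂ → 0 ≤ L.re ∧ L.im = 0) := by
  intro FT L
  have hFT (ψ : SchwartzMap ℝ ℂ) (K : ℝ) : FT ψ K = (1 / (Real.sqrt (2 * Real.pi)) : ℂ)
      * ∫ x : ℝ, Complex.exp (Complex.I * K * x) * ψ x := rfl
  refine ⟨?_, ?_⟩
  · obtain ⟨A₁, h₁⟩ := ψ₁.exists_eq_integral_cexp_mul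
    obtain ⟨A₂, h₂⟩ := ψ₂.exists_eq_integral_cexp_mul
    have hsqrt : ((Real.sqrt (2 * Real.pi) : ℝ) : ℂ) ^ 2 = 2 * Real.pi := by
      rw [← Complex.ofReal_pow, Real.sq_sqrt (by positivity)]
      push_cast
      rfl
    have hπ : (Real.pi : ℂ) ≠ 0 := Complex.ofReal_ne_zero.mpr Real.pi_ne_zero
    have hL : L = 1 / (Real.pi : ℂ) * ∫ K in Set.Ioi (0 : ℝ),
        (starRingEnd ℂ) (A₁ K) * A₂ K * (K : ℂ) := by
      rw [← integral_const_mul]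
      refine integral_congr_ae (ae_of_all _ fun K => ?_)
      simp only [hFT, ← h₁, ← h₂, map_mul, map_div₀, map_one, Complex.conj_ofReal]
      have hs : ((Real.sqrt (2 * Real.pi) : ℝ) : ℂ) ≠ 0 := by
        rw [← pow_ne_zero_iff two_ne_zero, hsqrt]
        exact mul_ne_zero two_ne_zero hπ
      field_simp
      rw [hsqrt]
      ring
    rw [hL]
    refine ((tendsto_integral_exp_neg_mul_mul
      (A₁.integrable_conj_mul_mul_id A₂)).const_mul (1 / (Real.pi : ℂ))).congr' ?_
    filter_upwards [self_mem_nhdsWithin] with ε hε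
    rw [integral_integral_div_sub_sub_sq h₁ h₂ hε, neg_mul_neg]
  · rintro rfl
    have hL : L = ((∫ K in Set.Ioi (0 : ℝ), Complex.normSq (FT ψ₁ K) * (2 * K) : ℝ) : ℂ) := by
      rw [← integral_complex_ofReal]
      refine integral_congr_ae (ae_of_all _ fun K => ?_)
      simpa using conj_mul_self_mul_ofReal (FT ψ₁ K) (2 * K)
    rw [hL, Complex.ofReal_re, Complex.ofReal_im]
    refine ⟨setIntegral_nonneg measurableSet_Ioi fun K hK => ?_, rfl⟩
    have : 0 < K := hK
    have := Complex.normSq_nonneg (FT ψ₁ K)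
    positivity
end
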